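/- arXiv:1710.07666 — 3 statements merged into one kernel-verified Lean document; each statement's English description precedes it below -/
import Mathlib

section
/- Let C be a symmetric monoidal category that is preadditive with binary biproducts and a zero object, and in which the tensor product is additive in each variable (monoidal preadditive). For objects M and N of C, the biproduct M ⊕ N is symtrivial if and only if M ⊗ N ≅ 0 and both M and N are symtrivial. -/
open CategoryTheory CategoryTheory.Limits CategoryTheory.MonoidalCategory ZeroObject

/-- A retract of a symtrivial object is symtrivial. -/
theorem braiding_self_eq_id_of_retract {C : Type*} [Category C] [MonoidalCategory C]
    [BraidedCategory C] {X Y : C} (r : Retract X Y) (h : (β_ Y Y).hom = 𝟙 (Y ⊗ Y)) :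
    (β_ X X).hom = 𝟙 (X ⊗ X) := by
  have key := BraidedCategory.braiding_naturality r.i r.i
  rw [h, Category.comp_id] at key
  simpa [tensorHom_comp_tensorHom] using (congrArg (· ≫ (r.r ⊗ₘ r.r)) key).symm

/-- If `M ⊞ N` is symtrivial, then `M ⊗ N` is a zero object. -/
theorem isZero_tensor_of_braiding_biprod_eq_id {C : Type*} [Category C] [Preadditive C]
    [MonoidalCategory C] [BraidedCategory C] [MonoidalPreadditive C] [HasBinaryBiproducts C]
    {M N : C} (h : (β_ (M ⊞ N) (M ⊞ N)).hom = 𝟙 ((M ⊞ N) ⊗ (M ⊞ N))) :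
    IsZero (M ⊗ N) := by
  have key := BraidedCategory.braiding_naturality (biprod.inl : M ⟶ M ⊞ N) (biprod.inr : N ⟶ M ⊞ N)
  rw [h, Category.comp_id] at key
  rw [IsZero.iff_id_eq_zero]
  simpa [tensorHom_comp_tensorHom] using
    congrArg (· ≫ ((biprod.fst : M ⊞ N ⟶ M) ⊗ₘ (biprod.snd : M ⊞ N ⟶ N))) key

/-- Two morphisms out of `(M ⊞ N) ⊗ (M ⊞ N)` agree if they agree on the four summands. -/
theorem biprod_tensor_biprod_hom_ext {C : Type*} [Category C] [Preadditive C]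
    [MonoidalCategory C] [MonoidalPreadditive C] [HasBinaryBiproducts C]
    {M N Z : C} {f g : (M ⊞ N) ⊗ (M ⊞ N) ⟶ Z}
    (hll : (biprod.inl ⊗ₘ biprod.inl) ≫ f = (biprod.inl ⊗ₘ biprod.inl) ≫ g)
    (hlr : (biprod.inl ⊗ₘ biprod.inr) ≫ f = (biprod.inl ⊗ₘ biprod.inr) ≫ g)
    (hrl : (biprod.inr ⊗ₘ biprod.inl) ≫ f = (biprod.inr ⊗ₘ biprod.inl) ≫ g)
    (hrr : (biprod.inr ⊗ₘ biprod.inr) ≫ f = (biprod.inr ⊗ₘ biprod.inr) ≫ g) :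
    f = g := by
  rw [← Category.id_comp f, ← Category.id_comp g, ← id_tensorHom_id, ← biprod.total]
  simp only [MonoidalPreadditive.tensor_add, MonoidalPreadditive.add_tensor,
    ← tensorHom_comp_tensorHom, Preadditive.add_comp, Category.assoc, hll, hlr, hrl, hrr]

/-- In a symmetric monoidal preadditive category with binary biproducts and a
zero object, the biproduct `M ⊞ N` is symtrivial if and only if `M ⊗ N ≅ 0` and both
`M` and `N` are symtrivial. -/
theorem stmt5 {C : Type*} [Category C] [Preadditive C] [MonoidalCategory C]
    [SymmetricCategory C] [MonoidalPreadditive C] [HasBinaryBiproducts C] [HasZeroObject C]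
    (M N : C) :
    (β_ (M ⊞ N) (M ⊞ N)).hom = 𝟙 ((M ⊞ N) ⊗ (M ⊞ N)) ↔
      (Nonempty (M ⊗ N ≅ 0) ∧ (β_ M M).hom = 𝟙 (M ⊗ M) ∧ (β_ N N).hom = 𝟙 (N ⊗ N)) := by
  constructor
  · intro h
    exact ⟨⟨(isZero_tensor_of_braiding_biprod_eq_id h).isoZero⟩,
      braiding_self_eq_id_of_retract ⟨biprod.inl, biprod.fst, biprod.inl_fst⟩ h,
      braiding_self_eq_id_of_retract ⟨biprod.inr, biprod.snd, biprod.inr_snd⟩ h⟩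
  · rintro ⟨⟨e⟩, hM, hN⟩
    have hMN : IsZero (M ⊗ N) := (isZero_zero C).of_iso e
    have hNM : IsZero (N ⊗ M) := hMN.of_iso (β_ N M)
    apply biprod_tensor_biprod_hom_ext
    · rw [BraidedCategory.braiding_naturality, hM, Category.id_comp, Category.comp_id]
    · exact hMN.eq_of_src _ _
    · exact hNM.eq_of_src _ _
    · rw [BraidedCategory.braiding_naturality, hN, Category.id_comp, Category.comp_id]
end

section
/- Let R → S be a faithfully flat map of commutative rings, let M be a finitely presented R-module, and let L be an R-submodule of M with inclusion i : L → M. If the induced S-linear map S ⊗_R L ⟶ S ⊗_R M admits an S-linear retraction (i.e. S ⊗_R L is a direct summand of S ⊗_R M), then the inclusion i admits an R-linear retraction r : M → L with r ∘ i = id_L, i.e. L is a direct summand of M. -/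
open TensorProduct

namespace Module.FaithfullyFlat

/-- Base change along `S` commutes with postcomposition by a linear map. -/
lemma equiv_isBaseChange_map_lTensor_compRight {R S P M N : Type*} [CommRing R] [CommRing S]
    [Algebra R S] [Module.Flat R S] [AddCommGroup P] [Module R P] [Module.FinitePresentation R P]
    [AddCommGroup M] [Module R M] [AddCommGroup N] [Module R N]
    (p : M →ₗ[R] N) (z : S ⊗[R] (P →ₗ[R] M)) :
    (Module.FinitePresentation.isBaseChange_map R P N S).equiv
        ((LinearMap.compRight R p).lTensor S z) =
      p.baseChange S ∘ₗ (Module.FinitePresentation.isBaseChange_map R P M S).equiv z := by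
  induction z with
  | zero => simp
  | add x y hx hy => simp [hx, hy, LinearMap.comp_add]
  | tmul s f =>
    simp [IsBaseChange.equiv_tmul, LinearMap.comp_smul, LinearMap.baseChange_comp]

/-- A linear map to a finitely presented module has a section if it has one after a
faithfully flat base change. -/
theorem exists_section_of_baseChange {R S M Q : Type*} [CommRing R] [CommRing S] [Algebra R S]
    [Module.FaithfullyFlat R S] [AddCommGroup M] [Module R M]
    [AddCommGroup Q] [Module R Q] [Module.FinitePresentation R Q] (p : M →ₗ[R] Q)
    (h : ∃ s : S ⊗[R] Q →ₗ[S] S ⊗[R] M, p.baseChange S ∘ₗ s = LinearMap.id) :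
    ∃ s : Q →ₗ[R] M, p ∘ₗ s = LinearMap.id := by
  obtain ⟨s, hs⟩ := h
  suffices hp : Function.Surjective (LinearMap.compRight R (M := Q) p) from hp LinearMap.id
  rw [← Module.FaithfullyFlat.lTensor_surjective_iff_surjective R S]
  intro y
  let eM := (Module.FinitePresentation.isBaseChange_map R Q M S).equiv
  let eQ := (Module.FinitePresentation.isBaseChange_map R Q Q S).equiv
  refine ⟨eM.symm (s ∘ₗ eQ y), eQ.injective ?_⟩
  rw [equiv_isBaseChange_map_lTensor_compRight, LinearEquiv.apply_symm_apply,
    ← LinearMap.comp_assoc, hs, LinearMap.id_comp]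

end Module.FaithfullyFlat

/-- Let `R → S` be a faithfully flat map of commutative rings, `M` a finitely
presented `R`-module and `L ⊆ M` an `R`-submodule.  If the induced `S`-linear map
`S ⊗[R] L ⟶ S ⊗[R] M` admits an `S`-linear retraction, then the inclusion `L → M` admits
an `R`-linear retraction, i.e. `L` is a direct summand of `M`. -/
theorem stmt10 {R S M : Type*} [CommRing R] [CommRing S] [Algebra R S]
    [Module.FaithfullyFlat R S]
    [AddCommGroup M] [Module R M] [Module.FinitePresentation R M]
    (L : Submodule R M)
    (h : ∃ g : S ⊗[R] M →ₗ[S] S ⊗[R] L,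
      g ∘ₗ (L.subtype.baseChange S) = LinearMap.id) :
    ∃ r : M →ₗ[R] L, r ∘ₗ L.subtype = LinearMap.id := by
  obtain ⟨g, hg⟩ := h
  have hgi (x : S ⊗[R] L) : g (L.subtype.baseChange S x) = x := LinearMap.congr_fun hg x
  have : Module.Finite S (S ⊗[R] L) := .of_surjective g fun x ↦ ⟨_, hgi x⟩
  have : Module.Finite R L := .of_finite_tensorProduct_of_faithfullyFlat S
  have : Module.FinitePresentation R (M ⧸ L) :=
    Module.finitePresentation_of_surjective L.mkQ L.mkQ_surjective
      (by rwa [Submodule.ker_mkQ, ← Module.Finite.iff_fg])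
  have hex : Function.Exact L.subtype L.mkQ := LinearMap.exact_subtype_mkQ L
  have hexS : Function.Exact (L.subtype.baseChange S) (L.mkQ.baseChange S) :=
    lTensor_exact S hex L.mkQ_surjective
  have hsecS : ∃ s, L.mkQ.baseChange S ∘ₗ s = LinearMap.id :=
    ((hexS.split_tfae (Function.LeftInverse.injective hgi)
      (LinearMap.lTensor_surjective S L.mkQ_surjective)).out 0 1).mpr (Exists.intro g hg)
  have hsec := Module.FaithfullyFlat.exists_section_of_baseChange L.mkQ hsecS
  exact ((hex.split_tfae L.subtype_injective L.mkQ_surjective).out 0 1).mp hsec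
end

section
/- Let R → S be a faithfully flat map of commutative rings and let M be an R-module such that S ⊗_R M is an invertible S-module (i.e. there is an S-module N with (S ⊗_R M) ⊗_S N ≅ S). Then M is an invertible R-module: there exists an R-module N′ with M ⊗_R N′ ≅ R. -/
open TensorProduct

universe u

/-- Finite presentation of modules descends along faithfully flat ring maps. -/
lemma Module.FinitePresentation.of_tensorProduct_of_faithfullyFlat {R M : Type*} (S : Type*)
    [CommRing R] [CommRing S] [Algebra R S] [Module.FaithfullyFlat R S]
    [AddCommGroup M] [Module R M] [Module.FinitePresentation S (S ⊗[R] M)] :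
    Module.FinitePresentation R M := by
  have : Module.Finite R M := .of_finite_tensorProduct_of_faithfullyFlat S
  obtain ⟨n, f, hf⟩ := Module.Finite.exists_fin' R M
  have hker : (LinearMap.ker (AlgebraTensorModule.lTensor S S f)).FG :=
    Module.FinitePresentation.fg_ker _ (LinearMap.lTensor_surjective S hf)
  have : Module.Finite S (LinearMap.ker (AlgebraTensorModule.lTensor S S f)) :=
    Module.Finite.iff_fg.mpr hker
  have : Module.Finite S (S ⊗[R] LinearMap.ker f) :=
    .equiv (LinearMap.tensorKerEquiv S S f).symm
  have : Module.Finite R (LinearMap.ker f) := .of_finite_tensorProduct_of_faithfullyFlat S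
  exact Module.finitePresentation_of_surjective f hf (Module.Finite.iff_fg.mp this)

/-- Formation of the dual of a finitely presented module commutes with flat base change. -/
noncomputable def Module.FinitePresentation.dualBaseChangeEquiv (R S M : Type*)
    [CommRing R] [CommRing S] [Algebra R S] [Module.Flat R S]
    [AddCommGroup M] [Module R M] [Module.FinitePresentation R M] :
    S ⊗[R] Module.Dual R M ≃ₗ[S] Module.Dual S (S ⊗[R] M) :=
  (Module.FinitePresentation.isBaseChange_map R M R S).equiv ≪≫ₗ
    (AlgebraTensorModule.rid R S S).congrRight

lemma Module.FinitePresentation.dualBaseChangeEquiv_tmul_tmul {R S M : Type*}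
    [CommRing R] [CommRing S] [Algebra R S] [Module.Flat R S]
    [AddCommGroup M] [Module R M] [Module.FinitePresentation R M]
    (s t : S) (f : Module.Dual R M) (m : M) :
    dualBaseChangeEquiv R S M (s ⊗ₜ f) (t ⊗ₜ m) = s * (f m • t) := by
  simp [dualBaseChangeEquiv, IsBaseChange.equiv_tmul, LinearEquiv.congrRight]

/-- Invertibility of modules descends along faithfully flat ring maps. -/
lemma Module.Invertible.of_tensorProduct_of_faithfullyFlat {R M : Type*} (S : Type*)
    [CommRing R] [CommRing S] [Algebra R S] [Module.FaithfullyFlat R S]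
    [AddCommGroup M] [Module R M] [Module.Invertible S (S ⊗[R] M)] :
    Module.Invertible R M := by
  have : Module.FinitePresentation S (S ⊗[R] M) := Module.finitePresentation_of_projective S _
  have : Module.FinitePresentation R M := .of_tensorProduct_of_faithfullyFlat S
  let e : S ⊗[R] (Module.Dual R M ⊗[R] M) ≃ₗ[S] S :=
    AlgebraTensorModule.distribBaseChange R S (Module.Dual R M) M ≪≫ₗ
      (Module.FinitePresentation.dualBaseChangeEquiv R S M).rTensor (S ⊗[R] M) ≪≫ₗ
      Module.Invertible.linearEquiv S (S ⊗[R] M)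
  have h : (AlgebraTensorModule.rid R S S).symm.toLinearMap ∘ₗ e.toLinearMap =
      (contractLeft R M).baseChange S := by
    ext f m
    simp [e, Module.Invertible.linearEquiv, TensorProduct.smul_tmul,
      Module.FinitePresentation.dualBaseChangeEquiv_tmul_tmul]
  constructor
  rw [← Module.FaithfullyFlat.lTensor_bijective_iff_bijective R S
    (N := Module.Dual R M ⊗[R] M), ← LinearMap.baseChange_eq_ltensor, ← h]
  exact (e ≪≫ₗ (AlgebraTensorModule.rid R S S).symm).bijective

/-- Let `R → S` be a faithfully flat map of commutative rings and `M` an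
`R`-module such that `S ⊗[R] M` is an invertible `S`-module (there is an `S`-module `N`
with `(S ⊗[R] M) ⊗[S] N ≅ S`).  Then `M` is an invertible `R`-module: there is an
`R`-module `N'` with `M ⊗[R] N' ≅ R`. -/
theorem stmt12 {R S M : Type u} [CommRing R] [CommRing S] [Algebra R S]
    [Module.FaithfullyFlat R S]
    [AddCommGroup M] [Module R M]
    (hinv : ∃ N : ModuleCat.{u} S,
      Nonempty (((S ⊗[R] M) ⊗[S] N) ≃ₗ[S] S)) :
    ∃ N' : ModuleCat.{u} R, Nonempty ((M ⊗[R] N') ≃ₗ[R] R) := by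
  obtain ⟨N, ⟨e⟩⟩ := hinv
  have : Module.Invertible S (S ⊗[R] M) := .left e
  have : Module.Invertible R M := .of_tensorProduct_of_faithfullyFlat S
  exact ⟨ModuleCat.of R (Module.Dual R M),
    ⟨TensorProduct.comm R M (Module.Dual R M) ≪≫ₗ Module.Invertible.linearEquiv R M⟩⟩
end
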